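/- Suppose that for all x ∈ X and all o ∈ {0,1,…,m} one has φ(x) + ⟨λ(o), T(x)⟩ − c(o) = ψ(x) + ⟨κ(o), S(x)⟩ − e(o), and that the m × n real matrix whose i-th row (i = 1,…,m) is λ(i) − λ(0) has rank n (full column rank). Then there exist a real n × n' matrix M and a vector b ∈ ℝⁿ such that T(x) = M · S(x) + b for every x ∈ X. -/

import Mathlib

open Matrix

/-- If for all `x ∈ X` and all environments `o ∈ {0, 1, …, m}` we have
`φ(x) + ⟨λ(o), T(x)⟩ − c(o) = ψ(x) + ⟨κ(o), S(x)⟩ − e(o)`, and the `m × n` matrix whose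
`i`-th row is `λ(i) − λ(0)` has rank `n` (full column rank), then there is a matrix `M`
and a vector `b` with `T(x) = M · S(x) + b` for all `x`. -/
theorem stmt0 {X : Type*} {n n' m : ℕ} (hn : 0 < n) (hn' : 0 < n') (hm : 0 < m)
    (T : X → Fin n → ℝ) (S : X → Fin n' → ℝ)
    (φ ψ : X → ℝ)
    (lam : Fin (m + 1) → Fin n → ℝ) (kap : Fin (m + 1) → Fin n' → ℝ)
    (c e : Fin (m + 1) → ℝ)
    (h : ∀ (x : X) (o : Fin (m + 1)),
      φ x + lam o ⬝ᵥ T x - c o = ψ x + kap o ⬝ᵥ S x - e o)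
    (hrank : (Matrix.of fun (i : Fin m) (j : Fin n) => lam i.succ j - lam 0 j).rank = n) :
    ∃ (M : Matrix (Fin n) (Fin n') ℝ) (b : Fin n → ℝ),
      ∀ x, T x = M.mulVec (S x) + b := by
  set A : Matrix (Fin m) (Fin n) ℝ :=
    Matrix.of fun (i : Fin m) (j : Fin n) => lam i.succ j - lam 0 j with hA
  have hker : LinearMap.ker A.mulVecLin = ⊥ := by
    have h1 := LinearMap.finrank_range_add_finrank_ker A.mulVecLin
    have h2 : Module.finrank ℝ (LinearMap.range A.mulVecLin) = n := hrank
    rw [h2, Module.finrank_fin_fun] at h1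
    exact Submodule.finrank_eq_zero.mp (by omega)
  obtain ⟨g, hg⟩ := LinearMap.exists_leftInverse_of_injective A.mulVecLin hker
  let K : Matrix (Fin m) (Fin n') ℝ := Matrix.of fun i j => kap i.succ j - kap 0 j
  let d : Fin m → ℝ := fun i => (c i.succ - c 0) - (e i.succ - e 0)
  refine ⟨LinearMap.toMatrix' (g ∘ₗ K.mulVecLin), g d, fun x => ?_⟩
  have key : A.mulVec (T x) = K.mulVec (S x) + d := by
    funext i
    have h0 := h x 0
    have h1 := h x i.succ
    have eA : A.mulVec (T x) i = lam i.succ ⬝ᵥ T x - lam 0 ⬝ᵥ T x := by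
      rw [← sub_dotProduct]; rfl
    have eK : K.mulVec (S x) i = kap i.succ ⬝ᵥ S x - kap 0 ⬝ᵥ S x := by
      rw [← sub_dotProduct]; rfl
    rw [Pi.add_apply, eA, eK]
    simp only [d]
    linarith
  have h2 : g (A.mulVec (T x)) = T x := LinearMap.congr_fun hg (T x)
  rw [LinearMap.toMatrix'_mulVec, LinearMap.comp_apply, Matrix.mulVecLin_apply, ← map_add,
    ← key, h2]
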